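/- Let U ⊂ ℝ³ be an open neighborhood of 0, let φ : U → ℝ be harmonic, let c > 0, and suppose Φ(x) = c/|x| + φ(x) is positive on U ∖ {0}. Then there exist δ > 0 with the closed ball of radius δ about 0 contained in U, and a smooth positive function Φ̃ on U ∖ {0}, such that: (i) Φ̃ = Φ on U ∖ B(0,δ); (ii) Φ̃^{1/4} is superharmonic on U ∖ {0}; and (iii) there are constants C₁, C₂ > 0 with C₁/|x|² ≤ Φ̃(x) ≤ C₂/|x|² for all x near 0. In particular, the conformally flat metric Φ̃·g_e on U ∖ {0} is complete at 0 and has nonnegative scalar curvature. -/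

import Mathlib

open scoped BigOperators

/-- The Laplacian of `f : ℝ³ → ℝ` at a point, computed as the sum of the second
directional derivatives along the standard orthonormal basis. -/
noncomputable def laplacian3 (f : EuclideanSpace ℝ (Fin 3) → ℝ)
    (x : EuclideanSpace ℝ (Fin 3)) : ℝ :=
  ∑ i : Fin 3,
    fderiv ℝ (fun y => fderiv ℝ f y (EuclideanSpace.single i 1)) x (EuclideanSpace.single i 1)

/-- `f` is harmonic on `s`: it is `C²` there and its Laplacian vanishes on `s`. -/
def HarmonicOn3 (f : EuclideanSpace ℝ (Fin 3) → ℝ) (s : Set (EuclideanSpace ℝ (Fin 3))) : Prop :=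
  ContDiffOn ℝ 2 f s ∧ ∀ x ∈ s, laplacian3 f x = 0

/-- `f` is superharmonic on `s`: it is `C²` there and its Laplacian is `≤ 0` on `s`. -/
def SuperharmonicOn3 (f : EuclideanSpace ℝ (Fin 3) → ℝ)
    (s : Set (EuclideanSpace ℝ (Fin 3))) : Prop :=
  ContDiffOn ℝ 2 f s ∧ ∀ x ∈ s, laplacian3 f x ≤ 0

local notation "E3" => EuclideanSpace ℝ (Fin 3)

open MeasureTheory Set Filter Topology

/-- A smooth radial weight on `ℝ³`, positive exactly on the open ball of radius `r`. -/
noncomputable def radialWeight (r : ℝ) (y : E3) : ℝ :=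
  Real.smoothTransition (r ^ 2 - ‖y‖ ^ 2)

lemma radialWeight_contDiff (r : ℝ) : ContDiff ℝ (⊤ : ℕ∞) (radialWeight r) :=
  Real.smoothTransition.contDiff.comp (contDiff_const.sub (contDiff_norm_sq ℝ))

lemma radialWeight_eq_zero {r : ℝ} (hr : 0 ≤ r) {y : E3} (hy : r ≤ ‖y‖) :
    radialWeight r y = 0 :=
  Real.smoothTransition.zero_of_nonpos (by nlinarith)

lemma hasCompactSupport_of_eq_zero {f : E3 → ℝ} {r : ℝ} (hf : ∀ y, r ≤ ‖y‖ → f y = 0) :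
    HasCompactSupport f :=
  HasCompactSupport.intro (isCompact_closedBall (0 : E3) r) fun y hy => hf y <| by
    simpa using (not_le.1 fun h => hy (by simpa using h)).le

lemma radialWeight_hasCompactSupport {r : ℝ} (hr : 0 ≤ r) :
    HasCompactSupport (radialWeight r) :=
  hasCompactSupport_of_eq_zero fun _ => radialWeight_eq_zero hr

lemma integral_radialWeight_pos {r : ℝ} (hr : 0 < r) : 0 < ∫ y, radialWeight r y := by
  refine (radialWeight_contDiff r).continuous.integral_pos_of_hasCompactSupport_nonneg_nonzero
    (radialWeight_hasCompactSupport hr.le) (fun y => Real.smoothTransition.nonneg _) (x := 0) ?_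
  exact (Real.smoothTransition.pos_of_pos (by simpa using pow_pos hr 2)).ne'

/-- The field `y ↦ radialWeight r y • y` is the gradient of a function supported in the ball
of radius `r`. -/
lemma exists_radialWeight_potential {r : ℝ} (hr : 0 ≤ r) :
    ∃ ψ : E3 → ℝ, (∀ y, r ≤ ‖y‖ → ψ y = 0) ∧
      ∀ y, HasFDerivAt ψ (radialWeight r y • innerSL ℝ y) y := by
  have hcont : Continuous fun u : ℝ => Real.smoothTransition (r ^ 2 - u) := by fun_prop
  refine ⟨fun y => 2⁻¹ * ∫ u in (r ^ 2)..(‖y‖ ^ 2), Real.smoothTransition (r ^ 2 - u), ?_, ?_⟩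
  · intro y hy
    have hle : r ^ 2 ≤ ‖y‖ ^ 2 := by nlinarith
    dsimp only
    rw [intervalIntegral.integral_congr (g := fun _ => (0 : ℝ))]
    · simp
    · intro u hu
      rw [uIcc_of_le hle] at hu
      exact Real.smoothTransition.zero_of_nonpos (by linarith [hu.1])
  · intro y
    have h1 := (hcont.integral_hasStrictDerivAt (r ^ 2) (‖y‖ ^ 2)).hasDerivAt
    have h2 := (h1.comp_hasFDerivAt y (hasStrictFDerivAt_norm_sq y).hasFDerivAt).const_mul 2⁻¹
    refine h2.congr_fderiv ?_
    ext v
    simp [radialWeight]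
    ring

lemma fderiv_apply_eq_sum (L : E3 →L[ℝ] ℝ) (y : E3) :
    L y = ∑ i : Fin 3, y i * L (EuclideanSpace.single i 1) := by
  conv_lhs => rw [← (EuclideanSpace.basisFun (Fin 3) ℝ).sum_repr y]
  simp [map_sum]

lemma contDiff_fderiv_apply {f : E3 → ℝ} (hf : ContDiff ℝ 2 f) (v : E3) :
    ContDiff ℝ 1 fun z => fderiv ℝ f z v :=
  (hf.fderiv_right (m := 1) (by norm_num)).clm_apply contDiff_const

lemma integral_fderiv_mul_radialWeight_eq_zero {f : E3 → ℝ} (hf : ContDiff ℝ 2 f) {r : ℝ}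
    (hr : 0 ≤ r) (x : E3) (t : ℝ) (hlap : ∀ y : E3, ‖y‖ < r → laplacian3 f (x - t • y) = 0) :
    ∫ y, fderiv ℝ f (x - t • y) y * radialWeight r y = 0 := by
  obtain ⟨ψ, hψ0, hψ⟩ := exists_radialWeight_potential hr
  have hψc : HasCompactSupport ψ := hasCompactSupport_of_eq_zero hψ0
  have hψcont : Continuous ψ := continuous_iff_continuousAt.2 fun y => (hψ y).continuousAt
  have hwcont := (radialWeight_contDiff r).continuous
  set e : Fin 3 → E3 := fun i => EuclideanSpace.single i 1
  set g : Fin 3 → E3 → ℝ := fun i y => fderiv ℝ f (x - t • y) (e i) with hg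
  have hgd : ∀ i, ContDiff ℝ 1 (g i) := fun i =>
    (contDiff_fderiv_apply hf (e i)).comp (by fun_prop)
  have hg' : ∀ i y, fderiv ℝ (g i) y (e i)
      = -(t * fderiv ℝ (fun z => fderiv ℝ f z (e i)) (x - t • y) (e i)) := by
    intro i y
    have h1 : HasFDerivAt (fun y : E3 => x - t • y) (-(t • ContinuousLinearMap.id ℝ E3)) y := by
      simpa using ((hasFDerivAt_id y).const_smul t).const_sub x
    have h2 := ((contDiff_fderiv_apply hf (e i)).differentiable (by norm_num)
      (x - t • y)).hasFDerivAt.comp y h1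
    have h3 : fderiv ℝ (g i) y = _ := h2.fderiv
    rw [h3]
    simp
  have hw' : ∀ i y, radialWeight r y * y i = fderiv ℝ ψ y (e i) := by
    intro i y
    rw [(hψ y).fderiv]
    simp [e, EuclideanSpace.inner_single_right]
  have hgψ : ∀ i, ∫ y, g i y * fderiv ℝ ψ y (e i) = -∫ y, fderiv ℝ (g i) y (e i) * ψ y := by
    intro i
    have hgc := (hgd i).continuous
    have hfc : Continuous fun y => fderiv ℝ (g i) y (e i) :=
      ((hgd i).continuous_fderiv (by norm_num)).clm_apply continuous_const
    apply integral_mul_fderiv_eq_neg_fderiv_mul_of_integrable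
    · exact (hfc.mul hψcont).integrable_of_hasCompactSupport hψc.mul_left
    · simp_rw [← hw']
      exact (hgc.mul (hwcont.mul (by fun_prop))).integrable_of_hasCompactSupport
        ((radialWeight_hasCompactSupport hr).mul_right.mul_left)
    · exact (hgc.mul hψcont).integrable_of_hasCompactSupport hψc.mul_left
    · exact fun y _ => (hgd i).differentiable (by norm_num) y
    · exact fun y _ => (hψ y).differentiableAt
  have hint : ∀ i, Integrable fun y => fderiv ℝ (g i) y (e i) * ψ y := fun i =>
    ((((hgd i).continuous_fderiv (by norm_num)).clm_apply
      continuous_const).mul hψcont).integrable_of_hasCompactSupport hψc.mul_left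
  have hint' : ∀ i, Integrable fun y => g i y * fderiv ℝ ψ y (e i) := by
    intro i
    simp_rw [← hw']
    exact ((hgd i).continuous.mul (hwcont.mul (by fun_prop))).integrable_of_hasCompactSupport
      ((radialWeight_hasCompactSupport hr).mul_right.mul_left)
  calc ∫ y, fderiv ℝ f (x - t • y) y * radialWeight r y
      = ∫ y, ∑ i, g i y * fderiv ℝ ψ y (e i) := by
        congr 1; ext y
        rw [fderiv_apply_eq_sum _ y, Finset.sum_mul]
        refine Finset.sum_congr rfl fun i _ => ?_
        rw [← hw']; simp only [hg, e]; ring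
    _ = -∑ i, ∫ y, fderiv ℝ (g i) y (e i) * ψ y := by
        rw [integral_finsetSum _ fun i _ => hint' i]
        simp [hgψ]
    _ = 0 := by
        rw [← integral_finsetSum _ fun i _ => hint i, neg_eq_zero]
        refine integral_eq_zero_of_ae (ae_of_all _ fun y => ?_)
        rcases le_or_gt r ‖y‖ with h | h
        · simp [hψ0 y h]
        · have := hlap y h
          rw [laplacian3] at this
          simp only [hg', ← Finset.sum_mul, Finset.sum_neg_distrib, ← Finset.mul_sum]
          simp only [e, this]
          simp

/-- **Mean value property** for a harmonic function, with a smooth radial weight. -/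
lemma integral_mul_radialWeight_eq {f : E3 → ℝ} (hf : ContDiff ℝ 2 f)
    (hfc : HasCompactSupport f) {r : ℝ} (hr : 0 ≤ r) (x : E3)
    (hlap : ∀ z ∈ Metric.ball x r, laplacian3 f z = 0) :
    ∫ y, f (x - y) * radialWeight r y = f x * ∫ y, radialWeight r y := by
  have hwcont := (radialWeight_contDiff r).continuous
  have hwc := radialWeight_hasCompactSupport hr
  have hf1 := hf.continuous_fderiv (by norm_num)
  obtain ⟨C, hC⟩ := (hfc.fderiv (𝕜 := ℝ)).exists_bound_of_continuous hf1
  have hderiv : ∀ t : ℝ, HasDerivAt (fun t : ℝ => ∫ y, f (x - t • y) * radialWeight r y)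
      (∫ y, -(fderiv ℝ f (x - t • y) y * radialWeight r y)) t := by
    intro t
    have hcontF : ∀ t : ℝ, Continuous fun y => f (x - t • y) * radialWeight r y := fun t =>
      (hf.continuous.comp (by fun_prop)).mul hwcont
    have hcontF' : Continuous fun y => -(fderiv ℝ f (x - t • y) y * radialWeight r y) :=
      (((hf1.comp (by fun_prop)).clm_apply continuous_id).mul hwcont).neg
    refine (hasDerivAt_integral_of_dominated_loc_of_deriv_le (s := univ)
      (F := fun t y => f (x - t • y) * radialWeight r y)
      (F' := fun t y => -(fderiv ℝ f (x - t • y) y * radialWeight r y))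
      (bound := fun y => C * ‖y‖ * ‖radialWeight r y‖) univ_mem
      (Eventually.of_forall fun t => (hcontF t).aestronglyMeasurable)
      ((hcontF t).integrable_of_hasCompactSupport hwc.mul_left)
      hcontF'.aestronglyMeasurable ?_ ?_ ?_).2
    · refine ae_of_all _ fun y t _ => ?_
      rw [norm_neg, norm_mul]
      gcongr
      exact ContinuousLinearMap.le_of_opNorm_le _ (hC _) _
    · exact ((continuous_const.mul continuous_norm).mul
        hwcont.norm).integrable_of_hasCompactSupport hwc.norm.mul_left
    · refine ae_of_all _ fun y t _ => ?_
      have h1 : HasDerivAt (fun t : ℝ => x - t • y) (-y) t := by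
        simpa using ((hasDerivAt_id t).smul_const y).const_sub x
      have h2 := ((hf.differentiable (by norm_num)
        (x - t • y)).hasFDerivAt.comp_hasDerivAt t h1).mul_const (radialWeight r y)
      simpa using h2
  have key := constant_of_has_deriv_right_zero (a := 0) (b := 1)
    (f := fun t : ℝ => ∫ y, f (x - t • y) * radialWeight r y)
    (fun t _ => (hderiv t).continuousAt.continuousWithinAt) (by
      intro t ht
      have := hderiv t
      rw [integral_neg, integral_fderiv_mul_radialWeight_eq_zero hf hr x t, neg_zero] at this
      · exact this.hasDerivWithinAt
      · intro y hy
        apply hlap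
        rw [Metric.mem_ball, dist_eq_norm]
        calc ‖x - t • y - x‖ = t * ‖y‖ := by
              rw [sub_sub_cancel_left, norm_neg, norm_smul, Real.norm_of_nonneg ht.1]
          _ ≤ 1 * ‖y‖ := by gcongr; exact ht.2.le
          _ < r := by simpa using hy) 1 (by simp)
  simpa [integral_const_mul] using key

lemma laplacian3_congr {f g : E3 → ℝ} {x : E3} (h : f =ᶠ[𝓝 x] g) :
    laplacian3 f x = laplacian3 g x := by
  unfold laplacian3
  refine Finset.sum_congr rfl fun i _ => ?_
  congr 1
  apply Filter.EventuallyEq.fderiv_eq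
  filter_upwards [h.eventuallyEq_nhds] with y hy
  rw [hy.fderiv_eq]

/-- Interior regularity: harmonic functions are smooth. -/
lemma HarmonicOn3.contDiffOn_infty {φ : E3 → ℝ} {U : Set E3} (hU : IsOpen U)
    (hφ : HarmonicOn3 φ U) : ContDiffOn ℝ (⊤ : ℕ∞) φ U := by
  intro x₀ hx₀
  apply ContDiffAt.contDiffWithinAt
  obtain ⟨R, hR, hRU⟩ := Metric.nhds_basis_closedBall.mem_iff.1 (hU.mem_nhds hx₀)
  let χ : ContDiffBump x₀ := ⟨R / 2, R, by positivity, by linarith⟩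
  set f : E3 → ℝ := fun x => χ x * φ x with hf_def
  have hfφ : ∀ x ∈ Metric.ball x₀ (R / 2), f =ᶠ[𝓝 x] φ := by
    intro x hx
    filter_upwards [Metric.isOpen_ball.mem_nhds hx] with y hy
    simp [f, χ.one_of_mem_closedBall (Metric.ball_subset_closedBall hy)]
  have hf : ContDiff ℝ 2 f := by
    rw [contDiff_iff_contDiffAt]
    intro x
    by_cases hx : x ∈ U
    · exact χ.contDiff.contDiffAt.mul (hφ.1.contDiffAt (hU.mem_nhds hx))
    · have : f =ᶠ[𝓝 x] fun _ => 0 := by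
        have hx' : x ∉ tsupport χ := fun h => hx (hRU (χ.tsupport_eq ▸ h))
        filter_upwards [notMem_tsupport_iff_eventuallyEq.1 hx'] with y hy
        simp [f, hy]
      exact contDiffAt_const.congr_of_eventuallyEq this
  have hfc : HasCompactSupport f := χ.hasCompactSupport.mul_right
  have hr : 0 < R / 4 := by positivity
  have hconv := (radialWeight_hasCompactSupport hr.le).contDiff_convolution_left
    (ContinuousLinearMap.mul ℝ ℝ) (μ := volume) (radialWeight_contDiff (R / 4))
    hf.continuous.locallyIntegrable
  refine (hconv.div_const (∫ y, radialWeight (R / 4) y)).contDiffAt.congr_of_eventuallyEq ?_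
  filter_upwards [Metric.ball_mem_nhds x₀ hr] with x hx
  have hx2 : x ∈ Metric.ball x₀ (R / 2) := Metric.ball_subset_ball (by linarith) hx
  rw [eq_div_iff (integral_radialWeight_pos hr).ne', ← (hfφ x hx2).eq_of_nhds,
    ← integral_mul_radialWeight_eq hf hfc hr.le x]
  · simp [MeasureTheory.convolution, mul_comm]
  · intro z hz
    have hz2 : z ∈ Metric.ball x₀ (R / 2) := by
      rw [Metric.mem_ball] at *
      linarith [dist_triangle z x x₀]
    rw [laplacian3_congr (hfφ z hz2)]
    exact hφ.2 z (hRU (Metric.ball_subset_closedBall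
      (Metric.ball_subset_ball (by linarith) hz2)))

lemma deriv_deriv_rpow (p : ℝ) {s : ℝ} (hs : 0 < s) :
    deriv (deriv fun u : ℝ => u ^ p) s = p * (p - 1) * s ^ (p - 2) := by
  have h : deriv (fun u : ℝ => u ^ p) =ᶠ[𝓝 s] fun u => p * u ^ (p - 1) := by
    filter_upwards [Ioi_mem_nhds hs] with u hu
    exact (Real.hasDerivAt_rpow_const (Or.inl (ne_of_gt hu))).deriv
  rw [h.deriv_eq, ((Real.hasDerivAt_rpow_const (Or.inl hs.ne')).const_mul p).deriv]
  ring_nf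

lemma contDiffOn_rpow (p : ℝ) : ContDiffOn ℝ (⊤ : ℕ∞) (fun s : ℝ => s ^ p) (Ioi 0) :=
  fun _ hs => (Real.contDiffAt_rpow_const_of_ne (ne_of_gt hs)).contDiffWithinAt

lemma exists_concave_profile {M : ℝ} (hM : 1 ≤ M) :
    ∃ G : ℝ → ℝ, ContDiffOn ℝ (⊤ : ℕ∞) G (Ioi 0) ∧
      (∀ s, 0 < s → s ≤ M → G s = s ^ (1 / 4 : ℝ)) ∧
      (∀ s, 0 < s → deriv (deriv G) s ≤ 0) ∧ (∀ s, 0 < s → 0 < G s) ∧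
      ∃ a, 0 < a ∧ ∃ b, 0 < b ∧ ∀ s, M + 1 ≤ s →
        a * s ^ (1 / 2 : ℝ) ≤ G s ∧ G s ≤ b * s ^ (1 / 2 : ℝ) := by
  set P : ℝ → ℝ := fun s => s ^ (1 / 4 : ℝ)
  set K : ℝ → ℝ := fun s => Real.smoothTransition (s - M) * s ^ (1 / 2 : ℝ)
  have hP : ContDiffOn ℝ (⊤ : ℕ∞) P (Ioi 0) := contDiffOn_rpow _
  have hK : ContDiffOn ℝ (⊤ : ℕ∞) K (Ioi 0) :=
    (Real.smoothTransition.contDiff.comp (contDiff_id.sub contDiff_const)).contDiffOn.mul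
      (contDiffOn_rpow _)
  have hP1 : ContDiffOn ℝ (⊤ : ℕ∞) (deriv P) (Ioi 0) := hP.deriv_of_isOpen isOpen_Ioi (by simp)
  have hK1 : ContDiffOn ℝ (⊤ : ℕ∞) (deriv K) (Ioi 0) := hK.deriv_of_isOpen isOpen_Ioi (by simp)
  have hK2 : ContDiffOn ℝ (⊤ : ℕ∞) (deriv (deriv K)) (Ioi 0) :=
    hK1.deriv_of_isOpen isOpen_Ioi (by simp)
  have hdiff : ∀ {f : ℝ → ℝ}, ContDiffOn ℝ (⊤ : ℕ∞) f (Ioi 0) → ∀ s, 0 < s →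
      DifferentiableAt ℝ f s := fun hf s hs =>
    (hf.contDiffAt (Ioi_mem_nhds hs)).differentiableAt (by simp)
  obtain ⟨C, hC⟩ := (isCompact_Icc (a := M) (b := M + 1)).exists_bound_of_continuousOn
    (hK2.continuousOn.mono fun s hs => (by linarith [hs.1] : (0 : ℝ) < s))
  have hC0 : 0 ≤ C := (norm_nonneg _).trans (hC M ⟨le_rfl, by linarith⟩)
  set ε : ℝ := 3 / 16 * (M + 1) ^ (-7 / 4 : ℝ) / (C + 1) with hε_def
  have hM1 : (0 : ℝ) < (M + 1) ^ (-7 / 4 : ℝ) := Real.rpow_pos_of_pos (by linarith) _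
  have hε : 0 < ε := by positivity
  have hK0 : ∀ s, s ≤ M → K s = 0 := fun s hs => by
    simp [K, Real.smoothTransition.zero_of_nonpos (sub_nonpos.2 hs)]
  have hKtop : ∀ s, M + 1 ≤ s → K s = s ^ (1 / 2 : ℝ) := fun s hs => by
    simp [K, Real.smoothTransition.one_of_one_le (show 1 ≤ s - M by linarith)]
  refine ⟨fun s => P s + ε * K s, hP.add (contDiffOn_const.mul hK), ?_, ?_, ?_, ε, hε, 1 + ε,
    by positivity, ?_⟩
  · intro s _ hsM
    simp [hK0 s hsM, P]
  · intro s hs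
    have h1 : deriv (fun s => P s + ε * K s) =ᶠ[𝓝 s] fun u => deriv P u + ε * deriv K u := by
      filter_upwards [Ioi_mem_nhds hs] with u hu
      exact ((hdiff hP u hu).hasDerivAt.add ((hdiff hK u hu).hasDerivAt.const_mul ε)).deriv
    rw [h1.deriv_eq, ((hdiff hP1 s hs).hasDerivAt.fun_add
      ((hdiff hK1 s hs).hasDerivAt.const_mul ε)).deriv, deriv_deriv_rpow _ hs]
    have hs7 : (0 : ℝ) < s ^ ((1 / 4 : ℝ) - 2) := Real.rpow_pos_of_pos hs _
    rcases lt_or_ge s M with h | h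
    · have : K =ᶠ[𝓝 s] fun _ => 0 := by
        filter_upwards [Iio_mem_nhds h] with u hu using hK0 u (le_of_lt hu)
      rw [this.deriv.deriv_eq]
      simp
      nlinarith
    rcases lt_or_ge (M + 1) s with h' | h'
    · have : K =ᶠ[𝓝 s] fun u => u ^ (1 / 2 : ℝ) := by
        filter_upwards [Ioi_mem_nhds h'] with u hu using hKtop u (le_of_lt hu)
      rw [this.deriv.deriv_eq, deriv_deriv_rpow _ hs]
      have hs3 : (0 : ℝ) < ε * s ^ ((1 / 2 : ℝ) - 2) := mul_pos hε (Real.rpow_pos_of_pos hs _)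
      nlinarith
    · have h1 : deriv (deriv K) s ≤ C + 1 := by
        linarith [(le_abs_self _).trans (hC s ⟨h, h'⟩)]
      have h2 : ε * deriv (deriv K) s ≤ 3 / 16 * (M + 1) ^ (-7 / 4 : ℝ) := by
        calc _ ≤ ε * (C + 1) := by gcongr
          _ = _ := by rw [hε_def]; field_simp
      have h3 : (M + 1) ^ (-7 / 4 : ℝ) ≤ s ^ ((1 / 4 : ℝ) - 2) := by
        rw [show (1 / 4 : ℝ) - 2 = -7 / 4 by norm_num]
        exact Real.rpow_le_rpow_of_nonpos hs h' (by norm_num)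
      nlinarith
  · intro s hs
    have h1 : 0 < P s := Real.rpow_pos_of_pos hs _
    have h2 : 0 ≤ K s := mul_nonneg (Real.smoothTransition.nonneg _) (Real.rpow_nonneg hs.le _)
    positivity
  · intro s hs
    have h1 : 0 < P s := Real.rpow_pos_of_pos (by linarith) _
    have h2 : P s ≤ s ^ (1 / 2 : ℝ) :=
      Real.rpow_le_rpow_of_exponent_le (by linarith) (by norm_num)
    simp only [hKtop s hs]
    constructor <;> linarith

lemma laplacian3_comp {G : ℝ → ℝ} {f : E3 → ℝ} {x : E3} (hG : ContDiffAt ℝ 2 G (f x))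
    (hf : ContDiffAt ℝ 2 f x) :
    laplacian3 (fun y => G (f y)) x =
      deriv (deriv G) (f x) * ∑ i : Fin 3, fderiv ℝ f x (EuclideanSpace.single i 1) ^ 2 +
        deriv G (f x) * laplacian3 f x := by
  have hG1 : DifferentiableAt ℝ (deriv G) (f x) :=
    ((hG.fderiv_right (m := 1) (by norm_num)).differentiableAt (by norm_num)).clm_apply
      (differentiableAt_const (1 : ℝ))
  have hf1 : DifferentiableAt ℝ (fderiv ℝ f) x :=
    (hf.fderiv_right (m := 1) (by norm_num)).differentiableAt (by norm_num)
  have hfx := hf.differentiableAt (by norm_num)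
  unfold laplacian3
  rw [Finset.mul_sum, Finset.mul_sum, ← Finset.sum_add_distrib]
  refine Finset.sum_congr rfl fun i _ => ?_
  set e : E3 := EuclideanSpace.single i 1
  have h1 : (fun y => fderiv ℝ (fun y => G (f y)) y e) =ᶠ[𝓝 x]
      fun y => deriv G (f y) * fderiv ℝ f y e := by
    filter_upwards [hf.eventually (by simp),
      hf.continuousAt.eventually (hG.eventually (by simp))] with y hy hGy
    have := (hGy.differentiableAt (by norm_num)).hasDerivAt.comp_hasFDerivAt y
      (hy.differentiableAt (by norm_num)).hasFDerivAt
    rw [show fderiv ℝ (fun y => G (f y)) y = _ from this.fderiv]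
    simp
  have h2 : HasFDerivAt (fun y => deriv G (f y)) (deriv (deriv G) (f x) • fderiv ℝ f x) x :=
    hG1.hasDerivAt.comp_hasFDerivAt x hfx.hasFDerivAt
  have h3 : DifferentiableAt ℝ (fun y => fderiv ℝ f y e) x :=
    hf1.clm_apply (differentiableAt_const _)
  rw [h1.fderiv_eq, (h2.fun_mul h3.hasFDerivAt).fderiv]
  simp
  ring

lemma laplacian3_add {f g : E3 → ℝ} {x : E3} (hf : ContDiffAt ℝ 2 f x)
    (hg : ContDiffAt ℝ 2 g x) :
    laplacian3 (fun y => f y + g y) x = laplacian3 f x + laplacian3 g x := by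
  have hd : ∀ {h : E3 → ℝ}, ContDiffAt ℝ 2 h x → ∀ v,
      DifferentiableAt ℝ (fun y => fderiv ℝ h y v) x := fun hh v =>
    ((hh.fderiv_right (m := 1) (by norm_num)).differentiableAt (by norm_num)).clm_apply
      (differentiableAt_const _)
  unfold laplacian3
  rw [← Finset.sum_add_distrib]
  refine Finset.sum_congr rfl fun i _ => ?_
  set e : E3 := EuclideanSpace.single i 1
  have h1 : (fun y => fderiv ℝ (fun y => f y + g y) y e) =ᶠ[𝓝 x]
      fun y => fderiv ℝ f y e + fderiv ℝ g y e := by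
    filter_upwards [hf.eventually (by simp), hg.eventually (by simp)] with y hfy hgy
    rw [fderiv_fun_add (hfy.differentiableAt (by norm_num)) (hgy.differentiableAt (by norm_num))]
    simp
  rw [h1.fderiv_eq, fderiv_fun_add (hd hf e) (hd hg e)]
  simp

lemma laplacian3_norm_sq (x : E3) : laplacian3 (fun y => ‖y‖ ^ 2) x = 6 := by
  have h : ∀ i : Fin 3, (fun y : E3 => fderiv ℝ (fun y => ‖y‖ ^ 2) y
      (EuclideanSpace.single i 1)) = fun y => 2 * EuclideanSpace.proj (𝕜 := ℝ) i y := by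
    intro i; ext y
    simp [EuclideanSpace.inner_single_right]
  unfold laplacian3
  simp_rw [h]
  have h2 : ∀ i : Fin 3, fderiv ℝ (fun y : E3 => 2 * EuclideanSpace.proj (𝕜 := ℝ) i y) x
      (EuclideanSpace.single i 1) = 2 := by
    intro i
    rw [fderiv_const_mul (by fun_prop), ContinuousLinearMap.fderiv]
    simp
  simp only [h2]
  norm_num

lemma laplacian3_div_norm (c : ℝ) {x : E3} (hx : x ≠ 0) :
    laplacian3 (fun y => c / ‖y‖) x = 0 := by
  have hx2 : 0 < ‖x‖ ^ 2 := by positivity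
  have h : (fun y : E3 => c / ‖y‖) = fun y => c * (‖y‖ ^ 2) ^ (-1 / 2 : ℝ) := by
    ext y
    rw [← Real.rpow_natCast, ← Real.rpow_mul (norm_nonneg _)]
    norm_num [Real.rpow_neg_one, div_eq_mul_inv]
  have hr : ContDiffAt ℝ 2 (fun s : ℝ => s ^ (-1 / 2 : ℝ)) (‖x‖ ^ 2) :=
    Real.contDiffAt_rpow_const_of_ne hx2.ne'
  rw [h, laplacian3_comp (G := fun s => c * s ^ (-1 / 2 : ℝ)) (contDiffAt_const.mul hr)
    (contDiff_norm_sq ℝ).contDiffAt, laplacian3_norm_sq]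
  have hd : deriv (fun s : ℝ => c * s ^ (-1 / 2 : ℝ)) =
      fun s => c * deriv (fun s : ℝ => s ^ (-1 / 2 : ℝ)) s := funext fun s =>
    deriv_const_mul_field c
  rw [hd, deriv_const_mul_field, deriv_deriv_rpow _ hx2]
  beta_reduce
  rw [(Real.hasDerivAt_rpow_const (Or.inl hx2.ne')).deriv]
  have h2 : ∑ i : Fin 3, fderiv ℝ (fun y : E3 => ‖y‖ ^ 2) x (EuclideanSpace.single i 1) ^ 2
      = 4 * ‖x‖ ^ 2 := by
    rw [EuclideanSpace.norm_sq_eq, Finset.mul_sum]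
    refine Finset.sum_congr rfl fun i _ => ?_
    simp [EuclideanSpace.inner_single_right]
    ring
  have h3 : (‖x‖ ^ 2) ^ ((-1 / 2 : ℝ) - 1) = (‖x‖ ^ 2) ^ ((-1 / 2 : ℝ) - 2) * ‖x‖ ^ 2 := by
    rw [← Real.rpow_add_one hx2.ne']; norm_num
  rw [h2, h3]
  ring

lemma rpow_quarter_pow_four {s : ℝ} (hs : 0 ≤ s) : (s ^ (1 / 4 : ℝ)) ^ 4 = s := by
  rw [← Real.rpow_natCast, ← Real.rpow_mul hs]; norm_num

lemma pow_four_rpow_quarter {s : ℝ} (hs : 0 ≤ s) : (s ^ 4) ^ (1 / 4 : ℝ) = s := by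
  rw [← Real.rpow_natCast, ← Real.rpow_mul hs]; norm_num

lemma rpow_half_pow_four {s : ℝ} (hs : 0 ≤ s) : (s ^ (1 / 2 : ℝ)) ^ 4 = s ^ 2 := by
  rw [← Real.rpow_natCast, ← Real.rpow_mul hs]; norm_num

/-- Modification of the conformal factor `Φ = c/|x| + φ` near the isolated
singularity `0`: there is a smooth positive `Φ̃` agreeing with `Φ` away from a
small ball, with `Φ̃^{1/4}` superharmonic, and `Φ̃ ≍ 1/|x|²` near `0`. -/
theorem conformal_factor_modification
    (U : Set (EuclideanSpace ℝ (Fin 3))) (hU : IsOpen U)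
    (h0 : (0 : EuclideanSpace ℝ (Fin 3)) ∈ U)
    (φ : EuclideanSpace ℝ (Fin 3) → ℝ) (hφ : HarmonicOn3 φ U)
    (c : ℝ) (hc : 0 < c)
    (hΦpos : ∀ x ∈ U \ ({0} : Set (EuclideanSpace ℝ (Fin 3))), 0 < c / ‖x‖ + φ x) :
    ∃ δ : ℝ, 0 < δ ∧ Metric.closedBall (0 : EuclideanSpace ℝ (Fin 3)) δ ⊆ U ∧
      ∃ Φt : EuclideanSpace ℝ (Fin 3) → ℝ,
        ContDiffOn ℝ (⊤ : ℕ∞) Φt (U \ {0}) ∧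
        (∀ x ∈ U \ ({0} : Set (EuclideanSpace ℝ (Fin 3))), 0 < Φt x) ∧
        (∀ x ∈ U \ Metric.ball (0 : EuclideanSpace ℝ (Fin 3)) δ, Φt x = c / ‖x‖ + φ x) ∧
        SuperharmonicOn3 (fun x => Φt x ^ (1/4 : ℝ)) (U \ {0}) ∧
        ∃ C₁ : ℝ, 0 < C₁ ∧ ∃ C₂ : ℝ, 0 < C₂ ∧ ∃ ρ : ℝ, 0 < ρ ∧
          ∀ x : EuclideanSpace ℝ (Fin 3), x ≠ 0 → ‖x‖ ≤ ρ →
            C₁ / ‖x‖ ^ 2 ≤ Φt x ∧ Φt x ≤ C₂ / ‖x‖ ^ 2 := by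
  have htwo : (2 : WithTop ℕ∞) ≤ ((⊤ : ℕ∞) : WithTop ℕ∞) := by
    exact WithTop.coe_le_coe.2 (le_top : (2 : ℕ∞) ≤ ⊤)
  have hV : IsOpen (U \ ({0} : Set E3)) := hU.sdiff isClosed_singleton
  set Φ : E3 → ℝ := fun x => c / ‖x‖ + φ x with hΦ_def
  have hφsmooth := hφ.contDiffOn_infty hU
  have hnorm : ∀ x : E3, x ≠ 0 → ContDiffAt ℝ (⊤ : ℕ∞) (fun y : E3 => c / ‖y‖) x :=
    fun x hx => contDiffAt_const.div (contDiffAt_norm ℝ hx) (norm_ne_zero_iff.2 hx)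
  have hΦsmooth : ∀ x ∈ U \ ({0} : Set E3), ContDiffAt ℝ (⊤ : ℕ∞) Φ x := fun x hx =>
    (hnorm x hx.2).add (hφsmooth.contDiffAt (hU.mem_nhds hx.1))
  have hΦlap : ∀ x ∈ U \ ({0} : Set E3), laplacian3 Φ x = 0 := fun x hx => by
    rw [hΦ_def, laplacian3_add ((hnorm x hx.2).of_le htwo)
      (hφ.1.contDiffAt (hU.mem_nhds hx.1)), laplacian3_div_norm c hx.2, hφ.2 x hx.1, add_zero]
  obtain ⟨δ, hδ, hδU⟩ := Metric.nhds_basis_closedBall.mem_iff.1 (hU.mem_nhds h0)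
  obtain ⟨B, hB⟩ := (isCompact_closedBall (0 : E3) δ).exists_bound_of_continuousOn
    (hφ.1.continuousOn.mono hδU)
  have hB' : ∀ x : E3, ‖x‖ ≤ δ → -B ≤ φ x ∧ φ x ≤ B := fun x hx =>
    abs_le.1 (hB x (by simpa using hx))
  have hB0 : 0 ≤ B := (norm_nonneg _).trans (hB 0 (by simpa using hδ.le))
  set M : ℝ := 2 * c / δ + B + 1 with hM_def
  have hM : 1 ≤ M := by
    have : 0 < 2 * c / δ := by positivity
    linarith
  have hΦM : ∀ x : E3, δ / 2 < ‖x‖ → ‖x‖ ≤ δ → Φ x ≤ M := by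
    intro x h1 h2
    have : c / ‖x‖ ≤ 2 * c / δ := by
      rw [div_le_div_iff₀ (by linarith) hδ]
      nlinarith
    simp only [hΦ_def]
    linarith [(hB' x h2).2]
  obtain ⟨G, hGs, hGM, hG2, hGpos, a, ha, b, hb, hab⟩ := exists_concave_profile hM
  set Φt : E3 → ℝ := fun x => if ‖x‖ < δ then G (Φ x) ^ 4 else Φ x with hΦt
  have hloc : ∀ x ∈ U \ ({0} : Set E3), ∃ g : ℝ → ℝ, ContDiffOn ℝ (⊤ : ℕ∞) g (Ioi 0) ∧
      (∀ s, 0 < s → 0 < g s) ∧ (∀ s, 0 < s → deriv (deriv g) s ≤ 0) ∧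
      Φt =ᶠ[𝓝 x] fun y => g (Φ y) ^ 4 := by
    intro x hx
    rcases lt_or_ge ‖x‖ δ with h | h
    · refine ⟨G, hGs, hGpos, hG2, ?_⟩
      filter_upwards [continuous_norm.continuousAt.eventually (Iio_mem_nhds h)] with y hy
      exact if_pos hy
    · refine ⟨fun s => s ^ (1 / 4 : ℝ), contDiffOn_rpow _, fun s hs => Real.rpow_pos_of_pos hs _,
        fun s hs => ?_, ?_⟩
      · rw [deriv_deriv_rpow _ hs]
        have := Real.rpow_pos_of_pos hs ((1 / 4 : ℝ) - 2)
        linarith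
      · filter_upwards [continuous_norm.continuousAt.eventually
          (Ioi_mem_nhds (show δ / 2 < ‖x‖ by linarith)), hV.mem_nhds hx] with y hy hyV
        have hy0 := hΦpos y hyV
        by_cases hyδ : ‖y‖ < δ
        · simp only [hΦt, if_pos hyδ, hGM (Φ y) hy0 (hΦM y hy hyδ.le)]
        · simp only [hΦt, if_neg hyδ]
          exact (rpow_quarter_pow_four hy0.le).symm
  have hgΦ : ∀ x ∈ U \ ({0} : Set E3), ∀ g : ℝ → ℝ, ContDiffOn ℝ (⊤ : ℕ∞) g (Ioi 0) →
      ContDiffAt ℝ (⊤ : ℕ∞) (fun y => g (Φ y)) x := fun x hx g hg =>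
    (hg.contDiffAt (Ioi_mem_nhds (hΦpos x hx))).comp x (hΦsmooth x hx)
  have hroot : ∀ x ∈ U \ ({0} : Set E3), ∃ g : ℝ → ℝ, ContDiffOn ℝ (⊤ : ℕ∞) g (Ioi 0) ∧
      (∀ s, 0 < s → deriv (deriv g) s ≤ 0) ∧
      (fun y => Φt y ^ (1 / 4 : ℝ)) =ᶠ[𝓝 x] fun y => g (Φ y) := by
    intro x hx
    obtain ⟨g, hg, hgpos, hg2, hev⟩ := hloc x hx
    refine ⟨g, hg, hg2, ?_⟩
    filter_upwards [hev, hV.mem_nhds hx] with y hy hyV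
    rw [hy, pow_four_rpow_quarter (hgpos _ (hΦpos y hyV)).le]
  refine ⟨δ, hδ, hδU, Φt, fun x hx => ?_, fun x hx => ?_, fun x hx => ?_,
    ⟨fun x hx => ?_, fun x hx => ?_⟩, ?_⟩
  · obtain ⟨g, hg, -, -, hev⟩ := hloc x hx
    exact (((hgΦ x hx g hg).pow 4).congr_of_eventuallyEq hev).contDiffWithinAt
  · obtain ⟨g, -, hgpos, -, hev⟩ := hloc x hx
    rw [hev.eq_of_nhds]
    exact pow_pos (hgpos _ (hΦpos x hx)) 4
  · exact if_neg fun h => hx.2 (by simpa using h)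
  · obtain ⟨g, hg, -, hev⟩ := hroot x hx
    exact (((hgΦ x hx g hg).congr_of_eventuallyEq hev).of_le
      htwo).contDiffWithinAt
  · obtain ⟨g, hg, hg2, hev⟩ := hroot x hx
    rw [laplacian3_congr hev, laplacian3_comp
      ((hg.contDiffAt (Ioi_mem_nhds (hΦpos x hx))).of_le htwo)
      ((hΦsmooth x hx).of_le htwo), hΦlap x hx, mul_zero, add_zero]
    exact mul_nonpos_of_nonpos_of_nonneg (hg2 _ (hΦpos x hx))
      (Finset.sum_nonneg fun i _ => sq_nonneg _)
  · refine ⟨a ^ 4 * (c / 2) ^ 2, by positivity, b ^ 4 * (2 * c) ^ 2, by positivity,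
      min (δ / 2) (c / (2 * (B + M + 1))), by positivity, fun x hx hxρ => ?_⟩
    have hx0 : 0 < ‖x‖ := norm_pos_iff.2 hx
    have hxδ : ‖x‖ < δ := by linarith [hxρ.trans (min_le_left _ _)]
    have hcx : 2 * (B + M + 1) ≤ c / ‖x‖ := by
      have := hxρ.trans (min_le_right _ _)
      rw [le_div_iff₀ (by linarith)] at this
      rw [le_div_iff₀ hx0]
      linarith
    obtain ⟨hφ1, hφ2⟩ := hB' x hxδ.le
    have hlow : c / 2 / ‖x‖ ≤ Φ x := by
      rw [div_right_comm]; simp only [hΦ_def]; linarith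
    have hupp : Φ x ≤ 2 * c / ‖x‖ := by
      rw [mul_div_assoc]; simp only [hΦ_def]; linarith
    have hΦ1 : M + 1 ≤ Φ x := by simp only [hΦ_def]; linarith
    have hΦ0 : 0 < Φ x := by linarith
    obtain ⟨h1, h2⟩ := hab (Φ x) hΦ1
    have hs := Real.rpow_nonneg hΦ0.le (1 / 2 : ℝ)
    rw [show Φt x = G (Φ x) ^ 4 from if_pos hxδ]
    constructor
    · calc a ^ 4 * (c / 2) ^ 2 / ‖x‖ ^ 2 = a ^ 4 * (c / 2 / ‖x‖) ^ 2 := by ring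
        _ ≤ a ^ 4 * Φ x ^ 2 := by gcongr
        _ = (a * Φ x ^ (1 / 2 : ℝ)) ^ 4 := by rw [mul_pow, rpow_half_pow_four hΦ0.le]
        _ ≤ G (Φ x) ^ 4 := by gcongr
    · calc G (Φ x) ^ 4 ≤ (b * Φ x ^ (1 / 2 : ℝ)) ^ 4 := by
            gcongr
            exact (hGpos _ hΦ0).le
        _ = b ^ 4 * Φ x ^ 2 := by rw [mul_pow, rpow_half_pow_four hΦ0.le]
        _ ≤ b ^ 4 * (2 * c / ‖x‖) ^ 2 := by gcongr
        _ = b ^ 4 * (2 * c) ^ 2 / ‖x‖ ^ 2 := by ring
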